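/- In dimension d ≥ 3, if a measure μ on ℝᵈ satisfies lim_{ε↓0} sup_{x∈ℝᵈ} ∫_{|x−y|≤ε} |x−y|^{2−d} μ(dy) = 0, then lim_{t↓0} sup_{x₀∈ℝᵈ} ∫₀ᵗ ∫_{ℝᵈ} (2πs)^{−d/2} exp(−|y−x₀|²/(2s)) μ(dy) ds = 0. -/

import Mathlib

open MeasureTheory Set
open scoped ENNReal

/-- The heat kernel is at most `s ^ (-d / 2)`. -/
lemma heatKernel_le_rpow (d : ℕ) {s : ℝ} (hs : 0 < s) (ρ : ℝ) :
    (2 * Real.pi * s) ^ (-(d : ℝ) / 2) * Real.exp (-ρ ^ 2 / (2 * s)) ≤ s ^ (-(d : ℝ) / 2) := by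
  have h1 : (2 * Real.pi * s) ^ (-(d : ℝ) / 2) ≤ s ^ (-(d : ℝ) / 2) := by
    apply Real.rpow_le_rpow_of_nonpos hs
    · nlinarith [Real.pi_gt_three]
    · have : (0 : ℝ) ≤ d := d.cast_nonneg
      linarith
  have h2 : Real.exp (-ρ ^ 2 / (2 * s)) ≤ 1 := by
    rw [Real.exp_le_one_iff, neg_div]
    have : 0 ≤ ρ ^ 2 / (2 * s) := by positivity
    linarith
  calc _ ≤ s ^ (-(d : ℝ) / 2) * 1 := by gcongr
    _ = _ := mul_one _

/-- Off the diagonal the heat kernel is at most a multiple of `s ^ (d / 2) / ρ ^ (2 * d)`. -/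
lemma heatKernel_le_div_pow (d : ℕ) {s ρ : ℝ} (hs : 0 < s) (hρ : 0 < ρ) :
    (2 * Real.pi * s) ^ (-(d : ℝ) / 2) * Real.exp (-ρ ^ 2 / (2 * s)) ≤
      2 ^ d * d.factorial * (s ^ ((d : ℝ) / 2) / ρ ^ (2 * d)) := by
  have h1 : (2 * Real.pi * s) ^ (-(d : ℝ) / 2) ≤ s ^ (-(d : ℝ) / 2) := by
    simpa using heatKernel_le_rpow d hs 0
  have hx : 0 < ρ ^ 2 / (2 * s) := by positivity
  have h2 : Real.exp (-ρ ^ 2 / (2 * s)) ≤ d.factorial * (2 * s) ^ d / ρ ^ (2 * d) := by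
    have h := Real.pow_div_factorial_le_exp _ hx.le d
    rw [neg_div, Real.exp_neg]
    calc (Real.exp (ρ ^ 2 / (2 * s)))⁻¹ ≤ ((ρ ^ 2 / (2 * s)) ^ d / d.factorial)⁻¹ :=
          inv_anti₀ (by positivity) h
      _ = _ := by
        rw [div_pow, pow_mul]
        field_simp
  have h3 : s ^ (-(d : ℝ) / 2) * s ^ d = s ^ ((d : ℝ) / 2) := by
    rw [← Real.rpow_natCast, ← Real.rpow_add hs]
    ring_nf
  calc _ ≤ s ^ (-(d : ℝ) / 2) * (d.factorial * (2 * s) ^ d / ρ ^ (2 * d)) := by gcongr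
    _ = 2 ^ d * d.factorial * (s ^ (-(d : ℝ) / 2) * s ^ d / ρ ^ (2 * d)) := by
      rw [mul_pow]; ring
    _ = _ := by rw [h3]

/-- The time integral of the heat kernel is at most a multiple of the Newtonian kernel. -/
lemma lintegral_heatKernel_le_rpow {d : ℕ} (hd : 3 ≤ d) (t : ℝ) {ρ : ℝ} (hρ : 0 < ρ) :
    ∫⁻ s in Ioc 0 t, ENNReal.ofReal
        ((2 * Real.pi * s) ^ (-(d : ℝ) / 2) * Real.exp (-ρ ^ 2 / (2 * s))) ≤
      ENNReal.ofReal ((2 ^ d * d.factorial + 2) * ρ ^ ((2 : ℝ) - d)) := by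
  have hd' : (3 : ℝ) ≤ d := by exact_mod_cast hd
  set p : ℝ → ℝ≥0∞ := fun s => ENNReal.ofReal
    ((2 * Real.pi * s) ^ (-(d : ℝ) / 2) * Real.exp (-ρ ^ 2 / (2 * s)))
  have hpow : (ρ ^ 2 : ℝ) ^ ((d : ℝ) / 2) = ρ ^ d := by
    rw [← Real.rpow_natCast ρ 2, ← Real.rpow_mul hρ.le, ← Real.rpow_natCast ρ d]
    congr 1; push_cast; ring
  have hdiv : ρ ^ d / ρ ^ (2 * d) * ρ ^ 2 = ρ ^ ((2 : ℝ) - d) := by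
    rw [Real.rpow_sub hρ, Real.rpow_natCast, Real.rpow_two, two_mul, pow_add]
    field_simp
  have hsmall : ∫⁻ s in Ioc 0 (ρ ^ 2), p s ≤
      ENNReal.ofReal (2 ^ d * d.factorial * ρ ^ ((2 : ℝ) - d)) := by
    calc ∫⁻ s in Ioc 0 (ρ ^ 2), p s
        ≤ ∫⁻ _ in Ioc 0 (ρ ^ 2), ENNReal.ofReal (2 ^ d * d.factorial * (ρ ^ d / ρ ^ (2 * d))) := by
          refine setLIntegral_mono measurable_const fun s hs => ENNReal.ofReal_le_ofReal ?_
          refine (heatKernel_le_div_pow d hs.1 hρ).trans ?_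
          rw [← hpow]
          have := hs.1.le
          have := hs.2
          gcongr
      _ = _ := by
          rw [setLIntegral_const, Real.volume_Ioc, sub_zero,
            ← ENNReal.ofReal_mul (by positivity), mul_assoc, hdiv]
  have hlarge : ∫⁻ s in Ioi (ρ ^ 2), p s ≤ ENNReal.ofReal (2 * ρ ^ ((2 : ℝ) - d)) := by
    have hlt : -(d : ℝ) / 2 < -1 := by linarith
    have hρ2 : 0 < ρ ^ 2 := by positivity
    calc ∫⁻ s in Ioi (ρ ^ 2), p s
        ≤ ∫⁻ s in Ioi (ρ ^ 2), ENNReal.ofReal (s ^ (-(d : ℝ) / 2)) :=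
          setLIntegral_mono (by fun_prop) fun s hs =>
            ENNReal.ofReal_le_ofReal (heatKernel_le_rpow d (hρ2.trans hs) ρ)
      _ = ENNReal.ofReal (∫ s in Ioi (ρ ^ 2), s ^ (-(d : ℝ) / 2)) := by
          rw [ofReal_integral_eq_lintegral_ofReal (integrableOn_Ioi_rpow_of_lt hlt hρ2)]
          filter_upwards [ae_restrict_mem measurableSet_Ioi] with s hs
          exact Real.rpow_nonneg (hρ2.trans hs).le _
      _ ≤ _ := by
          apply ENNReal.ofReal_le_ofReal
          rw [integral_Ioi_rpow_of_lt hlt hρ2, ← Real.rpow_natCast ρ 2, ← Real.rpow_mul hρ.le,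
            show ((2 : ℕ) : ℝ) * (-(d : ℝ) / 2 + 1) = 2 - d by push_cast; ring, neg_div,
            ← div_neg, div_le_iff₀ (by linarith)]
          have : 0 < ρ ^ ((2 : ℝ) - d) := Real.rpow_pos_of_pos hρ _
          nlinarith
  have hsub : Ioc 0 t ⊆ Ioc 0 (ρ ^ 2) ∪ Ioi (ρ ^ 2) := fun s hs => by
    rcases le_or_gt s (ρ ^ 2) with h | h
    · exact Or.inl ⟨hs.1, h⟩
    · exact Or.inr h
  calc ∫⁻ s in Ioc 0 t, p s ≤ ∫⁻ s in Ioc 0 (ρ ^ 2) ∪ Ioi (ρ ^ 2), p s := lintegral_mono_set hsub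
    _ ≤ _ := lintegral_union_le _ _ _
    _ ≤ _ := add_le_add hsmall hlarge
    _ = _ := by rw [← ENNReal.ofReal_add (by positivity) (by positivity), ← add_mul]

/-- Off the diagonal the time integral of the heat kernel over a short time `t` is `O(t)`. -/
lemma lintegral_heatKernel_le_mul (d : ℕ) {t ρ : ℝ} (ht : t ≤ 1) (hρ : 0 < ρ) :
    ∫⁻ s in Ioc 0 t, ENNReal.ofReal
        ((2 * Real.pi * s) ^ (-(d : ℝ) / 2) * Real.exp (-ρ ^ 2 / (2 * s))) ≤
      ENNReal.ofReal t * ENNReal.ofReal (2 ^ d * d.factorial / ρ ^ (2 * d)) := by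
  calc _ ≤ ∫⁻ _ in Ioc 0 t, ENNReal.ofReal (2 ^ d * d.factorial / ρ ^ (2 * d)) := by
        refine setLIntegral_mono measurable_const fun s hs => ENNReal.ofReal_le_ofReal ?_
        refine (heatKernel_le_div_pow d hs.1 hρ).trans ?_
        have : s ^ ((d : ℝ) / 2) ≤ 1 :=
          Real.rpow_le_one hs.1.le (hs.2.trans ht) (by positivity)
        rw [div_eq_mul_one_div (2 ^ d * (d.factorial : ℝ))]
        gcongr
    _ = _ := by rw [setLIntegral_const, Real.volume_Ioc, sub_zero, mul_comm]

/-- Comparison of an integral against a measure with uniformly bounded mass on balls of a fixed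
radius with an integral against a translation-invariant measure. -/
lemma measure_closedBall_mul_setLIntegral_le {E : Type*} [NormedAddCommGroup E]
    [MeasurableSpace E] [BorelSpace E] [SecondCountableTopology E]
    (ν μ : Measure E) [ν.IsAddLeftInvariant] [SFinite ν] [SFinite μ]
    {r : ℝ} {M : ℝ≥0∞} (hM : ∀ z, μ (Metric.closedBall z r) ≤ M) {S : Set E}
    {f F : E → ℝ≥0∞} (hf : Measurable f) (hF : Measurable F)
    (hfF : ∀ y ∈ S, ∀ z ∈ Metric.closedBall y r, f y ≤ F z) :
    ν (Metric.closedBall 0 r) * ∫⁻ y in S, f y ∂μ ≤ M * ∫⁻ z, F z ∂ν := by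
  have hD : MeasurableSet {q : E × E | dist q.2 q.1 ≤ r} :=
    (isClosed_le (by fun_prop) (by fun_prop)).measurableSet
  have hG : Measurable fun q : E × E =>
      {q : E × E | dist q.2 q.1 ≤ r}.indicator (fun q => F q.2) q :=
    (hF.comp measurable_snd).indicator hD
  calc ν (Metric.closedBall 0 r) * ∫⁻ y in S, f y ∂μ
      = ∫⁻ y in S, ν (Metric.closedBall 0 r) * f y ∂μ := (lintegral_const_mul _ hf).symm
    _ ≤ ∫⁻ y in S, ∫⁻ z, {q : E × E | dist q.2 q.1 ≤ r}.indicator (fun q => F q.2) (y, z) ∂ν ∂μ := by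
        refine setLIntegral_mono hG.lintegral_prod_right' fun y hy => ?_
        have hball : ν (Metric.closedBall y r) = ν (Metric.closedBall 0 r) := by
          rw [← measure_preimage_add ν y (Metric.closedBall y r), preimage_add_closedBall, sub_self]
        rw [← hball, mul_comm, ← setLIntegral_const,
          ← lintegral_indicator Metric.isClosed_closedBall.measurableSet]
        refine lintegral_mono fun z => ?_
        by_cases hz : dist z y ≤ r
        · simpa [indicator, hz] using hfF y hy z hz
        · simp [indicator, hz]
    _ ≤ ∫⁻ y, ∫⁻ z, {q : E × E | dist q.2 q.1 ≤ r}.indicator (fun q => F q.2) (y, z) ∂ν ∂μ :=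
        setLIntegral_le_lintegral _ _
    _ = ∫⁻ z, ∫⁻ y, {q : E × E | dist q.2 q.1 ≤ r}.indicator (fun q => F q.2) (y, z) ∂μ ∂ν :=
        lintegral_lintegral_swap hG.aemeasurable
    _ ≤ ∫⁻ z, M * F z ∂ν := by
        refine lintegral_mono fun z => ?_
        calc ∫⁻ y, {q : E × E | dist q.2 q.1 ≤ r}.indicator (fun q => F q.2) (y, z) ∂μ
            = ∫⁻ y, (Metric.closedBall z r).indicator (fun _ => F z) y ∂μ := by
              simp [indicator, dist_comm]
          _ = F z * μ (Metric.closedBall z r) :=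
              lintegral_indicator_const Metric.isClosed_closedBall.measurableSet _
          _ ≤ M * F z := by rw [mul_comm]; gcongr; exact hM z
    _ = _ := lintegral_const_mul _ hF

/-- A measure with uniformly bounded mass on balls of a fixed radius integrates
`‖y - x₀‖ ^ (-2 * d)` away from `x₀`, uniformly in `x₀`. -/
lemma exists_setLIntegral_compl_closedBall_le {d : ℕ} (hd : 1 ≤ d)
    (μ : Measure (EuclideanSpace ℝ (Fin d))) [SFinite μ] {ε : ℝ} (hε : 0 < ε) {M : ℝ≥0∞}
    (hM : ∀ z, μ (Metric.closedBall z ε) ≤ M) (hM_top : M ≠ ∞) {K : ℝ} (hK : 0 ≤ K) :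
    ∃ C : ℝ≥0∞, C ≠ ∞ ∧ ∀ x₀ : EuclideanSpace ℝ (Fin d),
      ∫⁻ y in (Metric.closedBall x₀ ε)ᶜ, ENNReal.ofReal (K / ‖y - x₀‖ ^ (2 * d)) ∂μ ≤ C := by
  set A : ℝ := ε⁻¹ + 2
  have hA : 0 < A := by positivity
  set F : EuclideanSpace ℝ (Fin d) → ℝ≥0∞ := fun z =>
    ENNReal.ofReal (K * A ^ (2 * d) * (1 + ‖z‖) ^ (-((2 * d : ℕ) : ℝ)))
  have hF : Measurable F := by fun_prop
  have hF_top : ∫⁻ z, F z ≠ ∞ := by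
    refine (Integrable.lintegral_lt_top ?_).ne
    refine (integrable_one_add_norm ?_).const_mul _
    rw [finrank_euclideanSpace_fin]
    exact_mod_cast (by omega : d < 2 * d)
  have hV : volume (Metric.closedBall (0 : EuclideanSpace ℝ (Fin d)) ε) ≠ 0 :=
    (Metric.measure_closedBall_pos _ _ hε).ne'
  have hV_top : volume (Metric.closedBall (0 : EuclideanSpace ℝ (Fin d)) ε) ≠ ∞ :=
    measure_closedBall_lt_top.ne
  refine ⟨M * (∫⁻ z, F z) / volume (Metric.closedBall (0 : EuclideanSpace ℝ (Fin d)) ε),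
    ENNReal.div_ne_top (ENNReal.mul_ne_top hM_top hF_top) hV, fun x₀ => ?_⟩
  rw [ENNReal.le_div_iff_mul_le (Or.inl hV) (Or.inl hV_top), mul_comm,
    ← lintegral_sub_right_eq_self F x₀]
  refine measure_closedBall_mul_setLIntegral_le volume μ hM (by fun_prop)
    (hF.comp (measurable_id.sub_const x₀)) fun y hy z hz => ENNReal.ofReal_le_ofReal ?_
  have hy' : ε < ‖y - x₀‖ := by simpa [dist_eq_norm] using hy
  have hz' : ‖z - y‖ ≤ ε := by simpa [dist_eq_norm] using hz
  have hle : 1 + ‖z - x₀‖ ≤ A * ‖y - x₀‖ := by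
    have h1 : 1 ≤ ε⁻¹ * ‖y - x₀‖ := by
      rw [inv_mul_eq_div, le_div_iff₀ hε]; linarith
    have h2 := norm_sub_le_norm_sub_add_norm_sub z y x₀
    simp only [A, add_mul]
    linarith
  have hpos : 0 < ‖y - x₀‖ := hε.trans hy'
  rw [Real.rpow_neg (by positivity), Real.rpow_natCast, mul_assoc, ← div_eq_mul_inv,
    div_eq_mul_inv K]
  gcongr
  rw [inv_le_iff_one_le_mul₀ (by positivity), div_mul_eq_mul_div,
    le_div_iff₀ (by positivity), one_mul, ← mul_pow]
  gcongr

/-- A local bound on the Newtonian potential bounds the mass of balls. -/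
lemma measure_closedBall_le_of_setLIntegral_rpow_le {E : Type*} [NormedAddCommGroup E]
    [MeasurableSpace E] [BorelSpace E] (μ : Measure E) {a ε : ℝ} (ha : a ≤ 0) (hε : 0 < ε)
    {B : ℝ≥0∞} {x : E} (h : ∫⁻ y in Metric.closedBall x ε, (‖x - y‖₊ : ℝ≥0∞) ^ a ∂μ ≤ B) :
    μ (Metric.closedBall x ε) ≤ B / ENNReal.ofReal ε ^ a := by
  have hε0 : ENNReal.ofReal ε ≠ 0 := by simpa using hε
  have h0 : ENNReal.ofReal ε ^ a ≠ 0 := by simp [ENNReal.rpow_eq_zero_iff, hε0, ha.not_gt]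
  have htop : ENNReal.ofReal ε ^ a ≠ ∞ := ENNReal.rpow_ne_top_of_ne_zero hε0 ENNReal.ofReal_ne_top
  rw [ENNReal.le_div_iff_mul_le (Or.inl h0) (Or.inl htop), mul_comm, ← setLIntegral_const]
  refine (setLIntegral_mono' Metric.isClosed_closedBall.measurableSet fun y hy => ?_).trans h
  rw [← neg_neg a, ENNReal.rpow_neg, ENNReal.rpow_neg _ (-a), ENNReal.inv_le_inv]
  refine ENNReal.rpow_le_rpow ?_ (neg_nonneg.2 ha)
  rw [← enorm_eq_nnnorm, ← ofReal_norm]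
  apply ENNReal.ofReal_le_ofReal
  rwa [← dist_eq_norm, dist_comm]

/-- In dimension `d ≥ 3`, the classical (elliptic) Kato condition on `μ` implies that
`μ(dy) ds` is of the parabolic Kato class. -/
theorem kato_class_dim_ge_three (d : ℕ) (hd : 3 ≤ d)
    (μ : Measure (EuclideanSpace ℝ (Fin d)))
    (hμ : ∀ δ > (0:ℝ), ∃ ε > (0:ℝ), ∀ x : EuclideanSpace ℝ (Fin d),
      (∫⁻ y in Metric.closedBall x ε,
        (‖x - y‖₊ : ℝ≥0∞) ^ ((2:ℝ) - (d:ℝ)) ∂μ) ≤ ENNReal.ofReal δ) :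
    ∀ δ > (0:ℝ), ∃ t₁ > (0:ℝ), ∀ t, 0 < t → t ≤ t₁ →
      ∀ x₀ : EuclideanSpace ℝ (Fin d),
      (∫⁻ s in Ioc (0:ℝ) t, ∫⁻ y,
        ENNReal.ofReal ((2 * Real.pi * s) ^ (-(d:ℝ)/2) *
          Real.exp (-‖y - x₀‖^2 / (2 * s))) ∂μ) ≤ ENNReal.ofReal δ := by
  intro δ hδ
  have hd' : (3 : ℝ) ≤ d := by exact_mod_cast hd
  set K : ℝ := 2 ^ d * d.factorial
  have hK : 0 < K := by positivity
  obtain ⟨ε, hε, hball⟩ := hμ (δ / 2 / (K + 2)) (by positivity)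
  set M : ℝ≥0∞ := ENNReal.ofReal (δ / 2 / (K + 2)) / ENNReal.ofReal ε ^ ((2 : ℝ) - d)
  have hM : ∀ z, μ (Metric.closedBall z ε) ≤ M := fun z =>
    measure_closedBall_le_of_setLIntegral_rpow_le μ (by linarith) hε (hball z)
  have hM_top : M ≠ ∞ := by
    refine ENNReal.div_ne_top ENNReal.ofReal_ne_top ?_
    rw [Ne, ENNReal.rpow_eq_zero_iff]
    rintro (⟨h, -⟩ | ⟨h, -⟩)
    · exact hε.not_ge (ENNReal.ofReal_eq_zero.1 h)
    · exact ENNReal.ofReal_ne_top h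
  have : IsLocallyFiniteMeasure μ := ⟨fun x =>
    ⟨_, Metric.closedBall_mem_nhds x hε, (hM x).trans_lt hM_top.lt_top⟩⟩
  obtain ⟨C, hC, hfar⟩ := exists_setLIntegral_compl_closedBall_le (by omega) μ hε hM hM_top hK.le
  refine ⟨min 1 (δ / 2 / (C.toReal + 1)), by positivity, fun t ht0 ht x₀ => ?_⟩
  have hswap : AEMeasurable (Function.uncurry fun (s : ℝ) (y : EuclideanSpace ℝ (Fin d)) =>
      ENNReal.ofReal ((2 * Real.pi * s) ^ (-(d:ℝ)/2) * Real.exp (-‖y - x₀‖^2 / (2 * s))))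
      ((volume.restrict (Ioc 0 t)).prod μ) := by
    apply Measurable.aemeasurable
    unfold Function.uncurry
    fun_prop
  rw [lintegral_lintegral_swap hswap,
    ← lintegral_add_compl _ (Metric.isClosed_closedBall (x := x₀) (ε := ε)).measurableSet,
    ← add_halves δ, ENNReal.ofReal_add (by positivity) (by positivity)]
  refine add_le_add ?_ ?_
  · calc _ ≤ ∫⁻ y in Metric.closedBall x₀ ε,
          ENNReal.ofReal (K + 2) * (‖x₀ - y‖₊ : ℝ≥0∞) ^ ((2:ℝ) - (d:ℝ)) ∂μ := by
          refine lintegral_mono fun y => ?_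
          rcases eq_or_ne y x₀ with rfl | hy
          · rw [sub_self, nnnorm_zero, ENNReal.coe_zero, ENNReal.zero_rpow_of_neg (by linarith),
              ENNReal.mul_top (by simpa using by positivity)]
            exact le_top
          · have hρ : 0 < ‖y - x₀‖ := norm_pos_iff.2 (sub_ne_zero.2 hy)
            rw [← enorm_eq_nnnorm, ← ofReal_norm, norm_sub_rev x₀ y, ENNReal.ofReal_rpow_of_pos hρ,
              ← ENNReal.ofReal_mul (by positivity)]
            exact lintegral_heatKernel_le_rpow hd t hρ
      _ = ENNReal.ofReal (K + 2) * ∫⁻ y in Metric.closedBall x₀ ε,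
          (‖x₀ - y‖₊ : ℝ≥0∞) ^ ((2:ℝ) - (d:ℝ)) ∂μ := lintegral_const_mul' _ _ ENNReal.ofReal_ne_top
      _ ≤ ENNReal.ofReal (K + 2) * ENNReal.ofReal (δ / 2 / (K + 2)) := by
          gcongr
          exact hball x₀
      _ = _ := by
          rw [← ENNReal.ofReal_mul (by positivity), mul_div_cancel₀ _ (by positivity)]
  · calc _ ≤ ∫⁻ y in (Metric.closedBall x₀ ε)ᶜ,
          ENNReal.ofReal t * ENNReal.ofReal (K / ‖y - x₀‖ ^ (2 * d)) ∂μ := by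
          refine setLIntegral_mono (by fun_prop) fun y hy => ?_
          have hy' : ε < ‖y - x₀‖ := by simpa [dist_eq_norm] using hy
          exact lintegral_heatKernel_le_mul d (ht.trans (min_le_left _ _)) (hε.trans hy')
      _ = ENNReal.ofReal t * ∫⁻ y in (Metric.closedBall x₀ ε)ᶜ,
          ENNReal.ofReal (K / ‖y - x₀‖ ^ (2 * d)) ∂μ := lintegral_const_mul' _ _ ENNReal.ofReal_ne_top
      _ ≤ ENNReal.ofReal t * ENNReal.ofReal C.toReal := by
          rw [ENNReal.ofReal_toReal hC]
          gcongr
          exact hfar x₀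
      _ ≤ _ := by
          rw [← ENNReal.ofReal_mul ht0.le]
          apply ENNReal.ofReal_le_ofReal
          have h := (le_div_iff₀ (by positivity)).1 (ht.trans (min_le_right _ _))
          nlinarith
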